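/- arXiv:math/9906164 — 4 statements merged into one kernel-verified Lean document; each statement's English description precedes it below -/
import Mathlib

section
/- Let X_∞ be the inverse limit of an inverse sequence of topological spaces X₁, X₂, … with continuous bonding maps f_j : X_{j+1} → X_j, and suppose every bonding map f_j has unique path lifting. Then the projection f₁ : X_∞ → X₁ onto the first coordinate has unique path lifting. -/
/-- A continuous map `q : X → Y` has *unique path lifting* if any two paths
`ω, ω' : [0,1] → X` with `q ∘ ω = q ∘ ω'` and `ω 0 = ω' 0` are equal. -/
def HasUniquePathLifting {X Y : Type*} [TopologicalSpace X] [TopologicalSpace Y]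
    (q : X → Y) : Prop :=
  ∀ ω ω' : C(unitInterval, X), (∀ s, q (ω s) = q (ω' s)) → ω 0 = ω' 0 → ω = ω'

/-- If every bonding map of an inverse sequence of topological spaces has unique
path lifting, then the projection of the inverse limit onto the first coordinate
has unique path lifting. -/
theorem invLimit_firstProj_hasUniquePathLifting {X : ℕ → Type*}
    [∀ j, TopologicalSpace (X j)] (f : ∀ j, X (j + 1) → X j)
    (hfc : ∀ j, Continuous (f j))
    (hupl : ∀ j, HasUniquePathLifting (f j)) :
    HasUniquePathLifting
      (fun x : {x : ∀ j, X j // ∀ j, f j (x (j + 1)) = x j} => (x : ∀ j, X j) 0) := by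
  intro ω ω' hq h0
  have key : ∀ n s, (ω s : ∀ j, X j) n = (ω' s : ∀ j, X j) n := by
    intro n
    induction n with
    | zero => exact hq
    | succ n ih =>
      let proj : C({x : ∀ j, X j // ∀ j, f j (x (j + 1)) = x j}, X (n + 1)) :=
        ⟨fun x => (x : ∀ j, X j) (n + 1), (continuous_apply (n + 1)).comp continuous_subtype_val⟩
      have h : proj.comp ω = proj.comp ω' := by
        refine hupl n _ _ (fun s => ?_) (congrArg proj h0)
        exact ((ω s).2 n).trans ((ih s).trans ((ω' s).2 n).symm)
      exact fun s => DFunLike.congr_fun h s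
  ext s n
  exact key n s
end

section
/- Let P = (p₁, p₂, …) be a sequence of nonzero integers and let p be a prime number. The group endomorphism of the 1-solenoid Σ_P given by x ↦ p·x (multiplication by p in each coordinate) is a topological group automorphism of Σ_P if and only if p divides p_i for infinitely many indices i. -/
noncomputable section

/-- The `1`-solenoid determined by a sequence `P` of integers: the inverse limit of
circles `ℝ/ℤ` where the `j`-th bonding map is multiplication by `P j`, realized as a
closed subgroup of the countable product of circles. -/
def Sol1 (P : ℕ → ℤ) : AddSubgroup (ℕ → AddCircle (1 : ℝ)) where
  carrier := {x | ∀ j, P j • x (j + 1) = x j}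
  zero_mem' := by
    intro j
    simp
  add_mem' := by
    intro a b ha hb j
    simp only [Pi.add_apply, smul_add, ha j, hb j]
  neg_mem' := by
    intro a ha j
    simp only [Pi.neg_apply, smul_neg, ha j]

/-- The sequence `t, t/p₁, t/(p₁p₂), …` of real numbers. -/
def sol1PiVec (P : ℕ → ℤ) (t : ℝ) : ℕ → ℝ
  | 0 => t
  | j + 1 => sol1PiVec P t j / (P j : ℝ)

/-- The canonical homomorphism `π_P : ℝ → Σ_P`,
`π_P t = (t, t/p₁, t/(p₁p₂), …) (mod 1)`. -/
def sol1Pi (P : ℕ → ℤ) (hP : ∀ j, P j ≠ 0) (t : ℝ) : Sol1 P :=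
  ⟨fun j => (sol1PiVec P t j : AddCircle (1 : ℝ)), by
    intro j
    have h2 : (P j : ℝ) ≠ 0 := by exact_mod_cast hP j
    show P j • ((sol1PiVec P t j / (P j : ℝ) : ℝ) : AddCircle (1 : ℝ))
        = ((sol1PiVec P t j : ℝ) : AddCircle (1 : ℝ))
    calc P j • ((sol1PiVec P t j / (P j : ℝ) : ℝ) : AddCircle (1 : ℝ))
        = ((P j • (sol1PiVec P t j / (P j : ℝ)) : ℝ) : AddCircle (1 : ℝ)) := by norm_cast
      _ = ((sol1PiVec P t j : ℝ) : AddCircle (1 : ℝ)) := by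
          rw [zsmul_eq_mul, mul_div_cancel₀ _ h2]⟩

/-- Composing bonding maps: the `j`-th coordinate is a product of terms of `P` times the
`m`-th coordinate. -/
lemma Sol1.prod_Ico_zsmul {P : ℕ → ℤ} (x : Sol1 P) {j m : ℕ} (h : j ≤ m) :
    (∏ i ∈ Finset.Ico j m, P i) • x.1 m = x.1 j := by
  induction m, h using Nat.le_induction with
  | base => simp
  | succ m hm ih => rw [Finset.prod_Ico_succ_top hm, mul_smul, x.2 m, ih]

lemma Sol1.isClosed (P : ℕ → ℤ) : IsClosed (Sol1 P : Set (ℕ → AddCircle (1 : ℝ))) := by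
  have h : (Sol1 P : Set (ℕ → AddCircle (1 : ℝ))) = ⋂ j, {x | P j • x (j + 1) = x j} := by
    ext x
    simp [Sol1]
  rw [h]
  exact isClosed_iInter fun j => isClosed_eq (by fun_prop) (by fun_prop)

instance (P : ℕ → ℤ) : CompactSpace (Sol1 P) :=
  isCompact_iff_compactSpace.mp (Sol1.isClosed P).isCompact

/-- If `p` divides infinitely many terms, some product of consecutive terms starting at `j`
is divisible by `p`. -/
lemma exists_dvd_prod_Ico {P : ℕ → ℤ} {p : ℤ} (h : {i : ℕ | p ∣ P i}.Infinite) (j : ℕ) :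
    ∃ m, j ≤ m ∧ p ∣ ∏ i ∈ Finset.Ico j m, P i := by
  obtain ⟨i, hi, hji⟩ := h.exists_gt j
  exact ⟨i + 1, by omega,
    Dvd.dvd.trans hi (Finset.dvd_prod_of_mem P (Finset.mem_Ico.mpr ⟨hji.le, i.lt_succ_self⟩))⟩

lemma Sol1.zsmul_injective {P : ℕ → ℤ} {p : ℤ} (h : {i : ℕ | p ∣ P i}.Infinite) :
    Function.Injective fun x : Sol1 P => p • x := by
  refine (injective_iff_map_eq_zero (zsmulAddGroupHom p : Sol1 P →+ Sol1 P)).mpr fun x hx => ?_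
  ext j
  obtain ⟨m, hjm, c, hc⟩ := exists_dvd_prod_Ico h j
  have hm : p • x.1 m = 0 := congrFun (congrArg Subtype.val hx) m
  rw [← Sol1.prod_Ico_zsmul x hjm, hc, mul_comm, mul_smul, hm, smul_zero]
  rfl

/-- The candidate for the `j`-th coordinate of `y / p` does not depend on the stage `m`. -/
lemma Sol1.prod_Ico_ediv_zsmul {P : ℕ → ℤ} {p : ℤ} (y : Sol1 P) {j m n : ℕ} (hjm : j ≤ m)
    (hmn : m ≤ n) (hp : p ∣ ∏ i ∈ Finset.Ico j m, P i) :
    ((∏ i ∈ Finset.Ico j n, P i) / p) • y.1 n = ((∏ i ∈ Finset.Ico j m, P i) / p) • y.1 m := by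
  rw [← Finset.prod_Ico_consecutive P hjm hmn, mul_comm, Int.mul_ediv_assoc _ hp, mul_comm,
    mul_smul, Sol1.prod_Ico_zsmul y hmn]

lemma Sol1.zsmul_surjective {P : ℕ → ℤ} {p : ℤ} (h : {i : ℕ | p ∣ P i}.Infinite) :
    Function.Surjective fun x : Sol1 P => p • x := by
  intro y
  choose m hjm hdvd using exists_dvd_prod_Ico h
  refine ⟨⟨fun j => ((∏ i ∈ Finset.Ico j (m j), P i) / p) • y.1 (m j), fun j => ?_⟩, ?_⟩
  · have hj : j < max (m j) (m (j + 1)) := (hjm (j + 1)).trans (le_max_right _ _)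
    beta_reduce
    rw [← Sol1.prod_Ico_ediv_zsmul y (hjm j) (le_max_left _ (m (j + 1))) (hdvd j),
      ← Sol1.prod_Ico_ediv_zsmul y (hjm (j + 1)) (le_max_right (m j) _) (hdvd (j + 1)),
      Finset.prod_eq_prod_Ico_succ_bot hj, Int.mul_ediv_assoc _ ?_, mul_smul]
    rw [← Finset.prod_Ico_consecutive P (hjm (j + 1)) (le_max_right (m j) _)]
    exact (hdvd (j + 1)).mul_right _
  · ext j
    change p • (((∏ i ∈ Finset.Ico j (m j), P i) / p) • y.1 (m j)) = y.1 j
    rw [← mul_smul, Int.mul_ediv_cancel' (hdvd j), Sol1.prod_Ico_zsmul y (hjm j)]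

/-- If the prime `p` divides only finitely many terms of `P`, then `Σ_P` has `p`-torsion. -/
lemma Sol1.exists_ne_zero_zsmul_eq_zero {P : ℕ → ℤ} {p : ℕ} (hp : p.Prime)
    (h : {i : ℕ | (p : ℤ) ∣ P i}.Finite) : ∃ x : Sol1 P, x ≠ 0 ∧ (p : ℤ) • x = 0 := by
  have := Fact.mk hp
  obtain ⟨N, hN⟩ : ∃ N, ∀ i, N ≤ i → (P i : ZMod p) ≠ 0 := by
    obtain ⟨M, hM⟩ := h.bddAbove
    refine ⟨M + 1, fun i hi hPi => ?_⟩
    have := hM ((ZMod.intCast_zmod_eq_zero_iff_dvd (P i) p).mp hPi)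
    omega
  let a : ℕ → ZMod p := fun j =>
    (∏ i ∈ Finset.Ico j N, (P i : ZMod p)) * (∏ i ∈ Finset.Ico N j, (P i : ZMod p))⁻¹
  have ha : ∀ j, P j • a (j + 1) = a j := by
    intro j
    rw [zsmul_eq_mul]
    rcases lt_or_ge j N with hj | hj
    · simp [a, Finset.prod_eq_prod_Ico_succ_bot hj, Finset.Ico_eq_empty_of_le hj.le,
        Finset.Ico_eq_empty_of_le (Nat.succ_le_of_lt hj)]
    · have := hN j hj
      simp [a, Finset.prod_Ico_succ_top hj, Finset.Ico_eq_empty_of_le hj,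
        Finset.Ico_eq_empty_of_le (hj.trans j.le_succ)]
      field_simp
  refine ⟨⟨fun j => ZMod.toAddCircle (a j), fun j => ?_⟩, fun h0 => ?_, ?_⟩
  · rw [← map_zsmul, ha]
  · have h1 : ZMod.toAddCircle (a N) = 0 := congrFun (congrArg Subtype.val h0) N
    rw [map_eq_zero_iff _ (ZMod.toAddCircle_injective p)] at h1
    simp [a] at h1
  · ext j
    change (p : ℤ) • ZMod.toAddCircle (a j) = 0
    rw [← map_zsmul, zsmul_eq_mul]
    simp

/-- For a prime `p`, multiplication by `p` on the `1`-solenoid `Σ_P` is a topological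
group automorphism if and only if `p` divides `p_i` for infinitely many `i`. -/
theorem sol1_mul_prime_automorphism_iff (P : ℕ → ℤ) (hP : ∀ j, P j ≠ 0)
    (p : ℕ) (hp : p.Prime) :
    (∃ e : ↥(Sol1 P) ≃ₜ ↥(Sol1 P),
      (∀ x y, e (x + y) = e x + e y) ∧ ∀ x, e x = (p : ℤ) • x) ↔
    {i : ℕ | (p : ℤ) ∣ P i}.Infinite := by
  constructor
  · rintro ⟨e, -, he⟩
    by_contra h
    obtain ⟨x, hx, hpx⟩ := Sol1.exists_ne_zero_zsmul_eq_zero hp (Set.not_infinite.mp h)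
    exact hx (e.injective (by rw [he, he, hpx, smul_zero]))
  · intro h
    have hc : Continuous fun x : Sol1 P => (p : ℤ) • x := continuous_zsmul _
    exact ⟨hc.homeoOfEquivCompactToT2
        (f := .ofBijective _ ⟨Sol1.zsmul_injective h, Sol1.zsmul_surjective h⟩),
      fun x y => smul_add (p : ℤ) x y, fun _ => rfl⟩

end
end

section
/- Let P and Q be sequences of nonzero integers and let r ∈ ℝ be irrational. Then there is no continuous function h : C_P → Σ_Q (C_P carrying the subspace topology from Σ_P) such that h(π_P(s)) = π_Q(r·s) for all s ∈ ℝ. -/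
noncomputable section

theorem sol1PiVec_eq_div_prod (P : ℕ → ℤ) (t : ℝ) (j : ℕ) :
    sol1PiVec P t j = t / ∏ i ∈ Finset.range j, (P i : ℝ) := by
  induction j with
  | zero => simp [sol1PiVec]
  | succ j ih => rw [sol1PiVec, ih, Finset.prod_range_succ, div_div]

theorem continuous_sol1Pi (P : ℕ → ℤ) (hP : ∀ j, P j ≠ 0) : Continuous (sol1Pi P hP) := by
  refine Continuous.subtype_mk (continuous_pi fun j => ?_) _
  simp only [sol1PiVec_eq_div_prod]
  exact (AddCircle.continuous_mk' (1 : ℝ)).comp (continuous_id.div_const _)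

theorem sol1Pi_zero (P : ℕ → ℤ) (hP : ∀ j, P j ≠ 0) : sol1Pi P hP 0 = 0 := by
  refine Subtype.ext (funext fun j => ?_)
  change ((sol1PiVec P 0 j : ℝ) : AddCircle (1 : ℝ)) = 0
  simp [sol1PiVec_eq_div_prod]

theorem sol1Pi_mem_pathComponent (P : ℕ → ℤ) (hP : ∀ j, P j ≠ 0) (t : ℝ) :
    sol1Pi P hP t ∈ pathComponent (0 : Sol1 P) := by
  have h := (PathConnectedSpace.joined (0 : ℝ) t).map (continuous_sol1Pi P hP)
  rwa [sol1Pi_zero] at h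

/-- The integer multiples of `p₁ ⋯ pₖ` are sent by `π_P` to points whose coordinates
up to the `k`-th vanish. -/
theorem sol1Pi_mul_prod_apply_eq_zero (P : ℕ → ℤ) (hP : ∀ j, P j ≠ 0) (m : ℤ) {j k : ℕ}
    (hjk : j ≤ k) :
    (sol1Pi P hP (m * ∏ i ∈ Finset.range k, (P i : ℝ)) : ℕ → AddCircle (1 : ℝ)) j = 0 := by
  have hne : ∏ i ∈ Finset.range j, (P i : ℝ) ≠ 0 :=
    Finset.prod_ne_zero_iff.2 fun i _ => Int.cast_ne_zero.2 (hP i)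
  change ((sol1PiVec P _ j : ℝ) : AddCircle (1 : ℝ)) = 0
  rw [sol1PiVec_eq_div_prod, ← Finset.prod_range_mul_prod_Ico _ hjk, mul_left_comm,
    mul_div_cancel_left₀ _ hne, AddCircle.coe_eq_zero_iff]
  exact ⟨m * ∏ i ∈ Finset.Ico j k, P i, by simp⟩

theorem tendsto_sol1Pi_mul_prod (P : ℕ → ℤ) (hP : ∀ j, P j ≠ 0) (m : ℕ → ℤ) :
    Filter.Tendsto (fun k => sol1Pi P hP (m k * ∏ i ∈ Finset.range k, (P i : ℝ)))
      Filter.atTop (nhds 0) := by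
  refine tendsto_subtype_rng.2 (tendsto_pi_nhds.2 fun j => ?_)
  refine tendsto_const_nhds.congr' ?_
  filter_upwards [Filter.eventually_ge_atTop j] with k hk
  exact (sol1Pi_mul_prod_apply_eq_zero P hP (m k) hk).symm

theorem exists_int_quarter_lt_norm_zsmul {x : ℝ} (hx : Irrational x) :
    ∃ m : ℤ, 1 / 4 < ‖m • (x : AddCircle (1 : ℝ))‖ := by
  have hd : DenseRange (· • (x : AddCircle (1 : ℝ)) : ℤ → AddCircle (1 : ℝ)) :=
    AddCircle.denseRange_zsmul_coe_iff.2 (by simpa using hx)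
  refine hd.exists_mem_open (isOpen_lt continuous_const continuous_norm)
    ⟨((1 / 2 : ℝ) : AddCircle (1 : ℝ)), ?_⟩
  simp only [Set.mem_ofPred_eq, AddCircle.norm_half_period_eq]
  norm_num

/-- For irrational `r`, there is no continuous map `h` from the path component `C_P`
of the identity in `Σ_P` to `Σ_Q` with `h (π_P s) = π_Q (r s)` for all `s ∈ ℝ`. -/
theorem sol1_irrational_multiplier_not_continuous (P Q : ℕ → ℤ)
    (hP : ∀ j, P j ≠ 0) (hQ : ∀ j, Q j ≠ 0) (r : ℝ) (hr : Irrational r) :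
    ¬ ∃ h : ↥(Sol1 P) → ↥(Sol1 Q),
        ContinuousOn h (pathComponent (0 : ↥(Sol1 P))) ∧
        ∀ s : ℝ, h (sol1Pi P hP s) = sol1Pi Q hQ (r * s) := by
  rintro ⟨h, hcont, hh⟩
  have hirr (k : ℕ) : Irrational (r * ∏ i ∈ Finset.range k, (P i : ℝ)) := by
    rw [← Int.cast_prod]
    exact hr.mul_intCast (Finset.prod_ne_zero_iff.2 fun i _ => hP i)
  choose m hm using fun k => exists_int_quarter_lt_norm_zsmul (hirr k)
  have hlim : Filter.Tendsto
      (fun k => h (sol1Pi P hP (m k * ∏ i ∈ Finset.range k, (P i : ℝ))))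
      Filter.atTop (nhds (h 0)) :=
    (hcont 0 (mem_pathComponent_self 0)).tendsto.comp
      (tendsto_nhdsWithin_iff.2 ⟨tendsto_sol1Pi_mul_prod P hP m,
        Filter.Eventually.of_forall fun k => sol1Pi_mem_pathComponent P hP _⟩)
  have h0 : h 0 = 0 := by simpa [sol1Pi_zero] using hh 0
  rw [h0] at hlim
  simp only [hh] at hlim
  have hnorm := (tendsto_pi_nhds.1 (tendsto_subtype_rng.1 hlim) 0).norm
  obtain ⟨k, hk⟩ := (hnorm.eventually_lt_const
    (show ‖((0 : Sol1 Q) : ℕ → AddCircle (1 : ℝ)) 0‖ < 1 / 4 by simp)).exists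
  refine lt_asymm hk ((hm k).trans_eq ?_)
  change _ = ‖((r * (m k * ∏ i ∈ Finset.range k, (P i : ℝ)) : ℝ) : AddCircle (1 : ℝ))‖
  rw [← AddCircle.coe_zsmul, zsmul_eq_mul, mul_left_comm]

end
end

section
/- Let P₁, …, Pₙ be sequences of nonzero integers, let G = ∏_{i=1}ⁿ Σ_{P_i}, and let π : ℝⁿ → G be the homomorphism π(t₁, …, tₙ) = (π_{P₁}(t₁), …, π_{Pₙ}(tₙ)). Let A = (a_{ij}) be an invertible n×n real matrix with inverse A⁻¹ = (b_{ij}). Then there exists a topological group automorphism h of G satisfying h ∘ π = π ∘ A if and only if for all i, j ∈ {1, …, n} both a_{ij} and b_{ij} are proper P_j → P_i multipliers. -/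
noncomputable section

/-- A real number `r` is a *proper `P → Q` multiplier* if there is a continuous group
homomorphism `u : Σ_P → Σ_Q` with `u (π_P s) = π_Q (r s)` for all `s ∈ ℝ`. -/
def IsProperMultiplier (P Q : ℕ → ℤ) (hP : ∀ j, P j ≠ 0) (hQ : ∀ j, Q j ≠ 0)
    (r : ℝ) : Prop :=
  ∃ u : ↥(Sol1 P) → ↥(Sol1 Q), Continuous u ∧ (∀ x y, u (x + y) = u x + u y) ∧
    ∀ s : ℝ, u (sol1Pi P hP s) = sol1Pi Q hQ (r * s)

@[simp]
theorem coe_sol1Pi (P : ℕ → ℤ) (hP : ∀ j, P j ≠ 0) (t : ℝ) (j : ℕ) :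
    (sol1Pi P hP t : ℕ → AddCircle (1 : ℝ)) j = (sol1PiVec P t j : AddCircle (1 : ℝ)) :=
  rfl

theorem sol1PiVec_add (P : ℕ → ℤ) (s t : ℝ) (j : ℕ) :
    sol1PiVec P (s + t) j = sol1PiVec P s j + sol1PiVec P t j := by
  induction j with
  | zero => rfl
  | succ j ih => simp only [sol1PiVec, ih, add_div]

/-- `sol1Pi` as an additive homomorphism. -/
def sol1PiHom (P : ℕ → ℤ) (hP : ∀ j, P j ≠ 0) : ℝ →+ Sol1 P :=
  AddMonoidHom.mk' (sol1Pi P hP) fun s t => by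
    ext j
    simp [sol1PiVec_add]

@[simp]
theorem sol1PiHom_apply (P : ℕ → ℤ) (hP : ∀ j, P j ≠ 0) (t : ℝ) :
    sol1PiHom P hP t = sol1Pi P hP t :=
  rfl

theorem exists_sol1PiVec_eq (P : ℕ → ℤ) (hP : ∀ j, P j ≠ 0) (N : ℕ) (r : ℝ) :
    ∃ t, sol1PiVec P t N = r := by
  induction N generalizing r with
  | zero => exact ⟨r, rfl⟩
  | succ N ih =>
    obtain ⟨t, ht⟩ := ih (r * P N)
    have hN : (P N : ℝ) ≠ 0 := by exact_mod_cast hP N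
    exact ⟨t, by rw [sol1PiVec, ht, mul_div_cancel_right₀ _ hN]⟩

theorem Sol1.apply_eq_of_le {P : ℕ → ℤ} {x y : Sol1 P} {N : ℕ}
    (h : (x : ℕ → AddCircle (1 : ℝ)) N = (y : ℕ → AddCircle (1 : ℝ)) N) {j : ℕ} (hj : j ≤ N) :
    (x : ℕ → AddCircle (1 : ℝ)) j = (y : ℕ → AddCircle (1 : ℝ)) j := by
  induction hj using Nat.decreasingInduction with
  | self => exact h
  | of_succ j _ ih => rw [← x.2 j, ← y.2 j, ih]

theorem denseRange_sol1Pi (P : ℕ → ℤ) (hP : ∀ j, P j ≠ 0) : DenseRange (sol1Pi P hP) := by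
  intro x
  have lift (N : ℕ) : ∃ t : ℝ, ∀ j ≤ N,
      (sol1Pi P hP t : ℕ → AddCircle (1 : ℝ)) j = (x : ℕ → AddCircle (1 : ℝ)) j := by
    obtain ⟨r, hr⟩ := QuotientAddGroup.mk_surjective ((x : ℕ → AddCircle (1 : ℝ)) N)
    obtain ⟨t, ht⟩ := exists_sol1PiVec_eq P hP N r
    refine ⟨t, fun j hj => Sol1.apply_eq_of_le ?_ hj⟩
    rw [coe_sol1Pi, ht]
    exact hr
  choose t ht using lift
  refine mem_closure_of_tendsto (f := fun N => sol1Pi P hP (t N)) (b := Filter.atTop) ?_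
    (Filter.Eventually.of_forall fun N => Set.mem_range_self _)
  rw [tendsto_subtype_rng, tendsto_pi_nhds]
  intro j
  refine tendsto_const_nhds.congr' ?_
  filter_upwards [Filter.eventually_ge_atTop j] with N hN using (ht N j hN).symm

theorem denseRange_pi_sol1Pi {n : ℕ} (P : Fin n → ℕ → ℤ) (hP : ∀ i j, P i j ≠ 0) :
    DenseRange fun (t : Fin n → ℝ) i => sol1Pi (P i) (hP i) (t i) :=
  DenseRange.piMap fun i => denseRange_sol1Pi (P i) (hP i)

/-- A matrix lifts through `π` to a continuous endomorphism of a product of solenoids exactly when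
its entries are proper multipliers. -/
theorem exists_continuous_lift_mulVec_iff {n : ℕ} (P : Fin n → ℕ → ℤ) (hP : ∀ i j, P i j ≠ 0)
    (M : Matrix (Fin n) (Fin n) ℝ) :
    (∃ f : (∀ i, Sol1 (P i)) → (∀ i, Sol1 (P i)), Continuous f ∧
      (∀ x y, f (x + y) = f x + f y) ∧
      ∀ t : Fin n → ℝ, f (fun i => sol1Pi (P i) (hP i) (t i)) =
        fun i => sol1Pi (P i) (hP i) (M.mulVec t i)) ↔
    ∀ i j, IsProperMultiplier (P j) (P i) (hP j) (hP i) (M i j) := by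
  constructor
  · rintro ⟨f, hf, hadd, hπ⟩ i j
    refine ⟨fun x => f (Pi.single j x) i, ?_, fun x y => ?_, fun s => ?_⟩
    · exact (continuous_apply i).comp (hf.comp (continuous_single (A := fun k => Sol1 (P k)) j))
    · simp only [Pi.single_add, hadd, Pi.add_apply]
    · have hsingle : Pi.single j (sol1Pi (P j) (hP j) s) =
          fun k => sol1Pi (P k) (hP k) ((Pi.single j s : Fin n → ℝ) k) := by
        funext k
        rcases eq_or_ne k j with rfl | hk
        · simp
        · simpa [hk] using (map_zero (sol1PiHom (P k) (hP k))).symm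
      simp [hsingle, hπ, Matrix.mulVec_single]
  · intro hM
    choose u hu hadd hπ using hM
    refine ⟨fun x i => ∑ j, u i j (x j), ?_, fun x y => ?_, fun t => ?_⟩
    · exact continuous_pi fun i => continuous_finsetSum _ fun j _ =>
        (hu i j).comp (continuous_apply j)
    · funext i
      simp [hadd, Finset.sum_add_distrib]
    · funext i
      simp only [hπ]
      simp only [← sol1PiHom_apply, ← map_sum]
      rfl

/-- Let `G = Σ_{P₁} × ⋯ × Σ_{Pₙ}` with `π : ℝⁿ → G` the product of the `π_{P_i}`, and
let `A` be an invertible real matrix with inverse `B`.  Then there is a topological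
group automorphism `h` of `G` with `h ∘ π = π ∘ A` if and only if all entries
`A i j` and `B i j` are proper `P_j → P_i` multipliers. -/
theorem prod_sol1_automorphism_iff_proper_multipliers {n : ℕ}
    (P : Fin n → ℕ → ℤ) (hP : ∀ i j, P i j ≠ 0)
    (A B : Matrix (Fin n) (Fin n) ℝ) (hAB : A * B = 1) (hBA : B * A = 1) :
    (∃ h : (∀ i, ↥(Sol1 (P i))) ≃ₜ (∀ i, ↥(Sol1 (P i))),
      (∀ x y, h (x + y) = h x + h y) ∧
      ∀ t : Fin n → ℝ,
        h (fun i => sol1Pi (P i) (hP i) (t i)) =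
          fun i => sol1Pi (P i) (hP i) (A.mulVec t i)) ↔
    (∀ i j, IsProperMultiplier (P j) (P i) (hP j) (hP i) (A i j) ∧
            IsProperMultiplier (P j) (P i) (hP j) (hP i) (B i j)) := by
  constructor
  · rintro ⟨h, hadd, hπ⟩
    have hA := (exists_continuous_lift_mulVec_iff P hP A).1 ⟨h, h.continuous, hadd, hπ⟩
    have hB := (exists_continuous_lift_mulVec_iff P hP B).1
      ⟨h.symm, h.symm.continuous, fun x y => h.injective (by simp [hadd]), fun t => by
        rw [h.symm_apply_eq, hπ, Matrix.mulVec_mulVec, hAB, Matrix.one_mulVec]⟩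
    exact fun i j => ⟨hA i j, hB i j⟩
  · intro hM
    obtain ⟨f, hf, hfadd, hfπ⟩ :=
      (exists_continuous_lift_mulVec_iff P hP A).2 fun i j => (hM i j).1
    obtain ⟨g, hg, -, hgπ⟩ :=
      (exists_continuous_lift_mulVec_iff P hP B).2 fun i j => (hM i j).2
    have hgf : g ∘ f = id := (denseRange_pi_sol1Pi P hP).equalizer (hg.comp hf) continuous_id <| by
      funext t
      simp [hfπ, hgπ, Matrix.mulVec_mulVec, hBA]
    have hfg : f ∘ g = id := (denseRange_pi_sol1Pi P hP).equalizer (hf.comp hg) continuous_id <| by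
      funext t
      simp [hfπ, hgπ, Matrix.mulVec_mulVec, hAB]
    exact ⟨⟨⟨f, g, congrFun hgf, congrFun hfg⟩, hf, hg⟩, hfadd, hfπ⟩

end
end
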